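/- Let S = ℂ[x_1,…,x_8] and for each integer m ≥ 1 let J_m be the ideal generated by the m-th powers of the eighteen monomials x_6x_7x_8, x_5x_7x_8, x_4x_6x_7, x_4x_5x_7, x_3x_6x_8, x_3x_5x_8, x_3x_4x_6, x_3x_4x_5, x_2x_6x_8, x_2x_5x_8, x_2x_4x_6, x_2x_4x_5, x_1x_6x_7, x_1x_5x_7, x_1x_3x_6, x_1x_3x_5, x_1x_2x_6, x_1x_2x_5. Then Ext^2_S(S/J_m, S) ≅ S/⟨x_5^m, x_6^m⟩; Ext^3_S(S/J_m, S) ≅ S/⟨x_2^m, x_3^m, x_7^m⟩ ⊕ S/⟨x_1^m, x_4^m, x_8^m⟩; Ext^4_S(S/J_m, S) ≅ S/⟨x_2^m, x_3^m, x_5^m, x_6^m, x_7^m⟩ ⊕ S/⟨x_1^m, x_4^m, x_5^m, x_6^m, x_8^m⟩; Ext^5_S(S/J_m, S) ≅ S/⟨x_1^m, x_2^m, x_3^m, x_4^m, x_7^m, x_8^m⟩; and Ext^6_S(S/J_m, S) ≅ S/⟨x_1^m, x_2^m, x_3^m, x_4^m, x_5^m, x_6^m, x_7^m, x_8^m⟩,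 as S-modules. -/

import Mathlib

open CategoryTheory Opposite MvPolynomial

noncomputable section

/-- `S = ℂ[x_1, …, x_8]` (with `x_i = X (i-1)`). -/
abbrev S8 : Type := MvPolynomial (Fin 8) ℂ

/-- `J_m`, the ideal generated by the `m`-th powers of the eighteen monomials
`x_6x_7x_8, x_5x_7x_8, x_4x_6x_7, x_4x_5x_7, x_3x_6x_8, x_3x_5x_8, x_3x_4x_6, x_3x_4x_5,
x_2x_6x_8, x_2x_5x_8, x_2x_4x_6, x_2x_4x_5, x_1x_6x_7, x_1x_5x_7, x_1x_3x_6, x_1x_3x_5,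
x_1x_2x_6, x_1x_2x_5`. -/
def J8 (m : ℕ) : Ideal S8 :=
  Ideal.span {(X 5 * X 6 * X 7) ^ m, (X 4 * X 6 * X 7) ^ m, (X 3 * X 5 * X 6) ^ m,
    (X 3 * X 4 * X 6) ^ m, (X 2 * X 5 * X 7) ^ m, (X 2 * X 4 * X 7) ^ m,
    (X 2 * X 3 * X 5) ^ m, (X 2 * X 3 * X 4) ^ m, (X 1 * X 5 * X 7) ^ m,
    (X 1 * X 4 * X 7) ^ m, (X 1 * X 3 * X 5) ^ m, (X 1 * X 3 * X 4) ^ m,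
    (X 0 * X 5 * X 6) ^ m, (X 0 * X 4 * X 6) ^ m, (X 0 * X 2 * X 5) ^ m,
    (X 0 * X 2 * X 4) ^ m, (X 0 * X 1 * X 5) ^ m, (X 0 * X 1 * X 4) ^ m}

/-- `Ext^i_S(S/J_m, S)`. -/
abbrev ExtJ8 (i m : ℕ) : Type :=
  ((Ext S8 (ModuleCat S8) i).obj (op (ModuleCat.of S8 (S8 ⧸ J8 m)))).obj
    (ModuleCat.of S8 S8)

section ExtComputation

universe u

variable {R : Type u} [CommRing R]

theorem smul_extMk {X Y : ModuleCat.{u} R} (P : ProjectiveResolution X) {n : ℕ}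
    (f : P.complex.X n ⟶ Y) (m : ℕ) (hm : n + 1 = m) (hf : P.complex.d m n ≫ f = 0) (r : R) :
    r • P.extMk f m hm hf = P.extMk (r • f) m hm (by rw [Linear.comp_smul, hf, smul_zero]) := by
  rw [Abelian.Ext.smul_eq_comp_mk₀, ProjectiveResolution.extMk_comp_mk₀]
  congr 1

/-- The class in `Ext` of a cocycle on a projective resolution. -/
def cocycleToExt {X : ModuleCat.{u} R} (P : ProjectiveResolution X) (Y : ModuleCat.{u} R) (k : ℕ) :
    LinearMap.ker ((P.complex.linearYonedaObj R Y).sc' k (k+1) (k+2)).g.hom →ₗ[R]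
      Abelian.Ext X Y (k+1) where
  toFun f := P.extMk (show P.complex.X (k+1) ⟶ Y from f.1) (k+2) rfl f.2
  map_add' f g := (P.add_extMk (show P.complex.X (k+1) ⟶ Y from f.1)
    (show P.complex.X (k+1) ⟶ Y from g.1) (k+2) rfl f.2 g.2).symm
  map_smul' r f := (smul_extMk P (show P.complex.X (k+1) ⟶ Y from f.1) (k+2) rfl f.2 r).symm

/-- The derived functors of `Hom` agree with the `Ext` groups of the abelian category. -/
theorem nonempty_ext_equiv (X Y : ModuleCat.{u} R) (k : ℕ) :
    Nonempty (((Ext R (ModuleCat.{u} R) (k+1)).obj (op X)).obj Y ≃ₗ[R] Abelian.Ext X Y (k+1)) := by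
  let P := ProjectiveResolution.of X
  let S := (P.complex.linearYonedaObj R Y).sc' k (k+1) (k+2)
  have e₁ : ((Ext R (ModuleCat.{u} R) (k+1)).obj (op X)).obj Y ≅ S.moduleCatLeftHomologyData.H :=
    P.isoExt (k+1) Y ≪≫
      (P.complex.linearYonedaObj R Y).homologyIsoSc' k (k+1) (k+2) (by simp) (by simp) ≪≫
      S.moduleCatHomologyIso
  have hker : LinearMap.range S.moduleCatToCycles = LinearMap.ker (cocycleToExt P Y k) := by
    ext f
    rw [LinearMap.mem_ker]
    refine Iff.trans ?_ (P.extMk_eq_zero_iff (show P.complex.X (k+1) ⟶ Y from f.1)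
      (k+2) rfl f.2 k rfl).symm
    constructor
    · rintro ⟨g, rfl⟩
      exact ⟨g, rfl⟩
    · rintro ⟨g, hg⟩
      exact ⟨g, Subtype.ext hg⟩
  have hsurj : Function.Surjective (cocycleToExt P Y k) := fun α => by
    obtain ⟨f, hf, h⟩ := P.extMk_surjective α (k+2) rfl
    exact ⟨⟨f, hf⟩, h⟩
  exact ⟨e₁.toLinearEquiv ≪≫ₗ Submodule.quotEquivOfEq _ _ hker ≪≫ₗ
    (cocycleToExt P Y k).quotKerEquivOfSurjective hsurj⟩

section LongExactSequence

open Abelian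

variable {T : ShortComplex (ModuleCat.{u} R)} (hT : T.ShortExact) (Y : ModuleCat.{u} R) (n : ℕ)

/-- Precomposition with a morphism, as a linear map between `Ext` modules. -/
def extPrecomp {X X' : ModuleCat.{u} R} (f : X ⟶ X') : Ext X' Y n →ₗ[R] Ext X Y n :=
  Ext.bilinearCompOfLinear R X X' Y 0 n n (zero_add n) (Ext.mk₀ f)

/-- The connecting map of the contravariant long exact sequence, as a linear map. -/
def extConnecting : Ext T.X₁ Y n →ₗ[R] Ext T.X₃ Y (n + 1) :=
  Ext.bilinearCompOfLinear R T.X₃ T.X₁ Y 1 n (n + 1) (add_comm 1 n) hT.extClass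

include hT in
theorem exact_extPrecomp : Function.Exact (extPrecomp Y n T.g) (extPrecomp Y n T.f) := by
  intro x
  refine ⟨fun h => Ext.contravariant_sequence_exact₂ hT Y x h, ?_⟩
  rintro ⟨z, rfl⟩
  simp [extPrecomp]

theorem exact_extPrecomp_extConnecting :
    Function.Exact (extPrecomp Y n T.f) (extConnecting hT Y n) := by
  intro x
  refine ⟨fun h => Ext.contravariant_sequence_exact₁ hT Y x (add_comm 1 n) h, ?_⟩
  rintro ⟨z, rfl⟩
  simp [extPrecomp, extConnecting]

theorem exact_extConnecting_extPrecomp :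
    Function.Exact (extConnecting hT Y n) (extPrecomp Y (n + 1) T.g) := by
  intro x
  refine ⟨fun h => Ext.contravariant_sequence_exact₃ hT Y x h (add_comm 1 n), ?_⟩
  rintro ⟨z, rfl⟩
  simp [extPrecomp, extConnecting]

include hT

theorem nonempty_ext_equiv_of_extPrecomp_eq_zero (h : extPrecomp Y n T.g = 0)
    [Subsingleton (Ext T.X₃ Y (n + 1))] : Nonempty (Ext T.X₁ Y n ≃ₗ[R] Ext T.X₂ Y n) := by
  refine ⟨(LinearEquiv.ofBijective (extPrecomp Y n T.f) ⟨?_, fun x => ?_⟩).symm⟩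
  · rw [injective_iff_map_eq_zero]
    intro x hx
    obtain ⟨z, rfl⟩ := (exact_extPrecomp hT Y n x).1 hx
    rw [h, LinearMap.zero_apply]
  · exact (exact_extPrecomp_extConnecting hT Y n x).1 (Subsingleton.elim _ _)

theorem nonempty_ext_equiv_ext_succ [Subsingleton (Ext T.X₂ Y n)]
    (h : extPrecomp Y (n + 1) T.g = 0) :
    Nonempty (Ext T.X₁ Y n ≃ₗ[R] Ext T.X₃ Y (n + 1)) := by
  refine ⟨LinearEquiv.ofBijective (extConnecting hT Y n) ⟨?_, fun x => ?_⟩⟩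
  · rw [injective_iff_map_eq_zero]
    intro x hx
    obtain ⟨z, rfl⟩ := (exact_extPrecomp_extConnecting hT Y n x).1 hx
    rw [Subsingleton.elim z 0, map_zero]
  · exact (exact_extConnecting_extPrecomp hT Y n x).1 (by rw [h, LinearMap.zero_apply])

theorem subsingleton_ext_X₁ [Subsingleton (Ext T.X₂ Y n)] [Subsingleton (Ext T.X₃ Y (n + 1))] :
    Subsingleton (Ext T.X₁ Y n) := by
  obtain ⟨e⟩ := nonempty_ext_equiv_ext_succ hT Y n (LinearMap.ext fun x => by
    rw [Subsingleton.elim x 0, map_zero, map_zero])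
  exact e.toEquiv.subsingleton

end LongExactSequence

section Product

open Abelian

variable (M N : Type u) [AddCommGroup M] [Module R M] [AddCommGroup N] [Module R N]

/-- `Ext` turns a product in the first variable into a product. -/
def extProdEquiv (Y : ModuleCat.{u} R) (n : ℕ) :
    Ext (ModuleCat.of R (M × N)) Y n ≃ₗ[R]
      Ext (ModuleCat.of R M) Y n × Ext (ModuleCat.of R N) Y n :=
  LinearEquiv.ofLinearMap
    ((extPrecomp Y n (ModuleCat.ofHom (LinearMap.inl R M N))).prod
      (extPrecomp Y n (ModuleCat.ofHom (LinearMap.inr R M N))))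
    ((extPrecomp Y n (ModuleCat.ofHom (LinearMap.fst R M N))).coprod
      (extPrecomp Y n (ModuleCat.ofHom (LinearMap.snd R M N))))
    (by
      ext x <;>
      simp [extPrecomp, ← ModuleCat.ofHom_comp, LinearMap.fst_comp_inl, LinearMap.fst_comp_inr,
        LinearMap.snd_comp_inl, LinearMap.snd_comp_inr])
    (by
      ext x
      change (Ext.mk₀ (ModuleCat.ofHom (LinearMap.fst R M N))).comp
          ((Ext.mk₀ (ModuleCat.ofHom (LinearMap.inl R M N))).comp x (zero_add n)) (zero_add n) +
        (Ext.mk₀ (ModuleCat.ofHom (LinearMap.snd R M N))).comp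
          ((Ext.mk₀ (ModuleCat.ofHom (LinearMap.inr R M N))).comp x (zero_add n)) (zero_add n) = x
      rw [Ext.mk₀_comp_mk₀_assoc, Ext.mk₀_comp_mk₀_assoc, ← Ext.add_comp, ← Ext.mk₀_add,
        ← ModuleCat.ofHom_comp, ← ModuleCat.ofHom_comp, ← ModuleCat.ofHom_add]
      have : (LinearMap.inl R M N).comp (LinearMap.fst R M N) +
          (LinearMap.inr R M N).comp (LinearMap.snd R M N) = LinearMap.id := by
        ext <;> simp
      rw [this]
      exact Ext.mk₀_id_comp x)

end Product

section CyclicModules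

open Abelian

/-- `Ext^n(R/I, R)`. -/
abbrev ExtQuot (I : Ideal R) (n : ℕ) : Type u :=
  Ext (ModuleCat.of R (R ⧸ I)) (ModuleCat.of R R) n

theorem exact_lsmul_factor {I I' : Ideal R} {x : R} (hI' : I' = I ⊔ Ideal.span {x}) :
    Function.Exact (LinearMap.lsmul R (R ⧸ I) x)
      (Submodule.factor (le_sup_left.trans hI'.ge : I ≤ I')) := by
  subst hI'
  intro y
  obtain ⟨f, rfl⟩ := Submodule.Quotient.mk_surjective I y
  change (Submodule.Quotient.mk f : R ⧸ (I ⊔ Ideal.span {x})) = 0 ↔ _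
  rw [Submodule.Quotient.mk_eq_zero]
  constructor
  · intro h
    obtain ⟨a, ha, b, hb, rfl⟩ := Submodule.mem_sup.1 h
    obtain ⟨c, rfl⟩ := Ideal.mem_span_singleton'.1 hb
    refine ⟨Submodule.Quotient.mk c, ?_⟩
    change (Submodule.Quotient.mk (x * c) : R ⧸ I) = _
    rw [Submodule.Quotient.eq]
    convert I.neg_mem ha using 1
    ring
  · rintro ⟨z, hz⟩
    obtain ⟨c, rfl⟩ := Submodule.Quotient.mk_surjective I z
    change (Submodule.Quotient.mk (x * c) : R ⧸ I) = _ at hz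
    rw [Submodule.Quotient.eq] at hz
    have h₁ : x * c ∈ I ⊔ Ideal.span {x} :=
      Ideal.mul_mem_right _ _ (Ideal.mem_sup_right (Ideal.mem_span_singleton_self x))
    have h₂ := Ideal.sub_mem _ h₁ (Ideal.mem_sup_left hz : _ ∈ I ⊔ Ideal.span {x})
    rwa [sub_sub_cancel] at h₂

theorem isSMulRegular_quotient_of_mul_mem {I : Ideal R} {x : R}
    (h : ∀ f, x * f ∈ I → f ∈ I) : IsSMulRegular (R ⧸ I) x := by
  refine isSMulRegular_iff_right_eq_zero_of_smul.2 fun y hy => ?_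
  obtain ⟨f, rfl⟩ := Submodule.Quotient.mk_surjective _ y
  rw [← Submodule.Quotient.mk_smul, Submodule.Quotient.mk_eq_zero] at hy
  exact (Submodule.Quotient.mk_eq_zero _).2 (h f hy)

theorem exact_lsmul_prodMap {M N M' N' : Type*} [AddCommGroup M] [Module R M]
    [AddCommGroup N] [Module R N] [AddCommGroup M'] [Module R M'] [AddCommGroup N'] [Module R N']
    {x : R} {f : M →ₗ[R] M'} {g : N →ₗ[R] N'} (hf : Function.Exact (LinearMap.lsmul R M x) f)
    (hg : Function.Exact (LinearMap.lsmul R N x) g) :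
    Function.Exact (LinearMap.lsmul R (M × N) x) (f.prodMap g) := by
  rintro ⟨y, z⟩
  rw [LinearMap.prodMap_apply, Prod.mk_eq_zero]
  refine (and_congr (hf y) (hg z)).trans ⟨?_, ?_⟩
  · rintro ⟨⟨y, rfl⟩, ⟨z, rfl⟩⟩
    exact ⟨(y, z), rfl⟩
  · rintro ⟨⟨y', z'⟩, h⟩
    exact ⟨⟨y', congrArg Prod.fst h⟩, ⟨z', congrArg Prod.snd h⟩⟩

theorem isSMulRegular_prod {M N : Type*} [AddCommGroup M] [Module R M] [AddCommGroup N]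
    [Module R N] {x : R} (hM : IsSMulRegular M x) (hN : IsSMulRegular N x) :
    IsSMulRegular (M × N) x :=
  fun _ _ h => Prod.ext (hM (congrArg Prod.fst h)) (hN (congrArg Prod.snd h))

/-- The sequence `0 → R/I → R/I → R/I' → 0` whose first map is multiplication by `x`. -/
def smulQuotComplex {I I' : Ideal R} {x : R} (hI' : I' = I ⊔ Ideal.span {x}) :
    ShortComplex (ModuleCat.{u} R) :=
  ShortComplex.mk (X₁ := ModuleCat.of R (R ⧸ I)) (x • 𝟙 (ModuleCat.of R (R ⧸ I)))
    (ModuleCat.ofHom (Submodule.factor (le_sup_left.trans hI'.ge : I ≤ I'))) (by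
      ext1
      exact LinearMap.ext fun y => ((exact_lsmul_factor hI') _).2 ⟨y, rfl⟩)

theorem smulQuotComplex_shortExact {I I' : Ideal R} {x : R} (hI' : I' = I ⊔ Ideal.span {x})
    (hx : IsSMulRegular (R ⧸ I) x) : (smulQuotComplex hI').ShortExact where
  exact := by
    rw [ShortComplex.ShortExact.moduleCat_exact_iff_function_exact]
    exact exact_lsmul_factor hI'
  mono_f := (ModuleCat.mono_iff_injective _).2 hx
  epi_g := (ModuleCat.epi_iff_surjective _).2
    (Submodule.factor_surjective (le_sup_left.trans hI'.ge : I ≤ I'))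

/-- The sequence `0 → R/(I ⊓ J) → R/I × R/J → R/(I ⊔ J) → 0`. -/
def mayerVietorisComplex (I J : Ideal R) : ShortComplex (ModuleCat.{u} R) :=
  ShortComplex.mk
    (ModuleCat.ofHom ((Submodule.factor (inf_le_left : I ⊓ J ≤ I)).prod
      (Submodule.factor (inf_le_right : I ⊓ J ≤ J))))
    (ModuleCat.ofHom ((Submodule.factor (le_sup_left : I ≤ I ⊔ J)).coprod
      (-Submodule.factor (le_sup_right : J ≤ I ⊔ J)))) (by
      ext1
      refine LinearMap.ext fun y => ?_
      obtain ⟨f, rfl⟩ := Submodule.Quotient.mk_surjective _ y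
      exact add_neg_cancel (Submodule.Quotient.mk f : R ⧸ (I ⊔ J)))

theorem mayerVietorisComplex_shortExact (I J : Ideal R) :
    (mayerVietorisComplex I J).ShortExact where
  exact := by
    rw [ShortComplex.moduleCat_exact_iff]
    rintro ⟨y, z⟩ h
    obtain ⟨f, rfl⟩ := Submodule.Quotient.mk_surjective _ y
    obtain ⟨g, rfl⟩ := Submodule.Quotient.mk_surjective _ z
    replace h : (Submodule.Quotient.mk f : R ⧸ (I ⊔ J)) + -Submodule.Quotient.mk g = 0 := h
    rw [← sub_eq_add_neg, sub_eq_zero, Submodule.Quotient.eq] at h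
    obtain ⟨a, ha, b, hb, hab⟩ := Submodule.mem_sup.1 h
    refine ⟨Submodule.Quotient.mk (f - a), Prod.ext ?_ ?_⟩
    · change (Submodule.Quotient.mk (f - a) : R ⧸ I) = Submodule.Quotient.mk f
      rw [Submodule.Quotient.eq]
      simpa using ha
    · change (Submodule.Quotient.mk (f - a) : R ⧸ J) = Submodule.Quotient.mk g
      rw [Submodule.Quotient.eq]
      convert hb using 1
      linear_combination -hab
  mono_f := by
    refine (ModuleCat.mono_iff_injective _).2 ((injective_iff_map_eq_zero _).2 fun y h => ?_)
    obtain ⟨f, rfl⟩ := Submodule.Quotient.mk_surjective _ y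
    have h₁ : (Submodule.Quotient.mk f : R ⧸ I) = 0 := congrArg Prod.fst h
    have h₂ : (Submodule.Quotient.mk f : R ⧸ J) = 0 := congrArg Prod.snd h
    rw [Submodule.Quotient.mk_eq_zero] at h₁ h₂
    exact (Submodule.Quotient.mk_eq_zero _).2 ⟨h₁, h₂⟩
  epi_g := by
    refine (ModuleCat.epi_iff_surjective _).2 fun y => ?_
    obtain ⟨f, rfl⟩ := Submodule.Quotient.mk_surjective _ y
    refine ⟨(Submodule.Quotient.mk f, 0), ?_⟩
    change (Submodule.Quotient.mk f : R ⧸ (I ⊔ J)) + -0 = _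
    rw [neg_zero, add_zero]

theorem extPrecomp_smul_id (X Y : ModuleCat.{u} R) (n : ℕ) (x : R) :
    extPrecomp Y n (x • 𝟙 X) = LinearMap.lsmul R (Ext X Y n) x := by
  ext y
  simp [extPrecomp, Ext.mk₀_smul]

theorem nonempty_extQuot_succ_equiv {I I' : Ideal R} {x : R} (hI' : I' = I ⊔ Ideal.span {x})
    (hx : IsSMulRegular (R ⧸ I) x) {n : ℕ} (hn : IsSMulRegular (ExtQuot I (n + 1)) x)
    {N N' : Type*} [AddCommGroup N] [Module R N] [AddCommGroup N'] [Module R N']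
    (e : ExtQuot I n ≃ₗ[R] N) (q : N →ₗ[R] N') (hq : Function.Surjective q)
    (hxq : Function.Exact (LinearMap.lsmul R N x) q) :
    Nonempty (ExtQuot I' (n + 1) ≃ₗ[R] N') := by
  have hT := smulQuotComplex_shortExact hI' hx
  let δ : ExtQuot I n →ₗ[R] ExtQuot I' (n + 1) := extConnecting hT (ModuleCat.of R R) n
  have hδ : Function.Surjective δ := fun y => by
    refine (exact_extConnecting_extPrecomp hT (ModuleCat.of R R) n y).1 (hn ?_)
    have h := exact_extPrecomp hT (ModuleCat.of R R) (n + 1)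
    have h' := h.apply_apply_eq_zero y
    erw [extPrecomp_smul_id] at h'
    exact h'.trans (smul_zero x).symm
  have hker : LinearMap.ker δ = LinearMap.ker (q ∘ₗ e.toLinearMap) := by
    ext y
    have h := exact_extPrecomp_extConnecting hT (ModuleCat.of R R) n y
    erw [extPrecomp_smul_id] at h
    refine h.trans (Iff.trans ?_ (hxq (e y)).symm)
    constructor
    · rintro ⟨z, rfl⟩
      exact ⟨e z, (e.map_smul x z).symm⟩
    · rintro ⟨z, hz⟩
      refine ⟨e.symm z, e.injective ?_⟩
      rw [← hz]
      exact (e.map_smul x _).trans (congrArg (x • ·) (e.apply_symm_apply z))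
  exact ⟨(δ.quotKerEquivOfSurjective hδ).symm ≪≫ₗ Submodule.quotEquivOfEq _ _ hker ≪≫ₗ
    (q ∘ₗ e.toLinearMap).quotKerEquivOfSurjective (hq.comp e.surjective)⟩

theorem subsingleton_extQuot_succ {I I' : Ideal R} {x : R} (hI' : I' = I ⊔ Ideal.span {x})
    (hx : IsSMulRegular (R ⧸ I) x) {n : ℕ} (hn : IsSMulRegular (ExtQuot I (n + 1)) x)
    [Subsingleton (ExtQuot I n)] : Subsingleton (ExtQuot I' (n + 1)) := by
  obtain ⟨e⟩ := nonempty_extQuot_succ_equiv hI' hx hn (LinearEquiv.refl R _)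
    (0 : _ →ₗ[R] PUnit) (fun y => ⟨0, rfl⟩)
    (fun y => ⟨fun _ => ⟨0, Subsingleton.elim _ _⟩, fun _ => rfl⟩)
  exact e.toEquiv.subsingleton

theorem subsingleton_extQuot_zero {I I' : Ideal R} {x : R} (hI' : I' = I ⊔ Ideal.span {x})
    (hx : IsSMulRegular (R ⧸ I) x) (hn : IsSMulRegular (ExtQuot I 0) x) :
    Subsingleton (ExtQuot I' 0) := by
  have hT := smulQuotComplex_shortExact hI' hx
  have := hT.epi_g
  refine subsingleton_of_forall_eq 0 fun y => (injective_iff_map_eq_zero _).1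
    (Ext.precomp_mk₀_injective_of_epi (ModuleCat.of R R) (smulQuotComplex hI').g) y (hn ?_)
  have h' := (exact_extPrecomp hT (ModuleCat.of R R) 0).apply_apply_eq_zero y
  erw [extPrecomp_smul_id] at h'
  exact h'.trans (smul_zero x).symm

/-- The modules `Ext^n(R/I, R)` vanish except for `n = a`, where one gets `N₁`, and `n = b`,
where one gets `N₂`. -/
structure ExtConcentrated (I : Ideal R) (a b : ℕ) (N₁ N₂ : Type*) [AddCommGroup N₁] [Module R N₁]
    [AddCommGroup N₂] [Module R N₂] : Prop where
  fst : Nonempty (ExtQuot I a ≃ₗ[R] N₁)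
  snd : Nonempty (ExtQuot I b ≃ₗ[R] N₂)
  subsingleton : ∀ n, n ≠ a → n ≠ b → Subsingleton (ExtQuot I n)

namespace ExtConcentrated

variable {I I' : Ideal R} {a b : ℕ} {N₁ N₂ N₁' N₂' : Type*} [AddCommGroup N₁] [Module R N₁]
    [AddCommGroup N₂] [Module R N₂] [AddCommGroup N₁'] [Module R N₁']
    [AddCommGroup N₂'] [Module R N₂']

theorem isSMulRegular (h : ExtConcentrated I a b N₁ N₂) {x : R} (h₁ : IsSMulRegular N₁ x)
    (h₂ : IsSMulRegular N₂ x) (n : ℕ) : IsSMulRegular (ExtQuot I n) x := by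
  obtain ⟨⟨e₁⟩, ⟨e₂⟩, h₀⟩ := h
  by_cases ha : n = a
  · subst ha
    exact (LinearEquiv.isSMulRegular_congr e₁ x).2 h₁
  by_cases hb : n = b
  · subst hb
    exact (LinearEquiv.isSMulRegular_congr e₂ x).2 h₂
  · have := h₀ n ha hb
    exact fun _ _ _ => Subsingleton.elim _ _

theorem quotient (h : ExtConcentrated I a b N₁ N₂) {x : R} (hI' : I' = I ⊔ Ideal.span {x})
    (hx : IsSMulRegular (R ⧸ I) x) (h₁ : IsSMulRegular N₁ x) (h₂ : IsSMulRegular N₂ x)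
    (q₁ : N₁ →ₗ[R] N₁') (hq₁ : Function.Surjective q₁)
    (hxq₁ : Function.Exact (LinearMap.lsmul R N₁ x) q₁)
    (q₂ : N₂ →ₗ[R] N₂') (hq₂ : Function.Surjective q₂)
    (hxq₂ : Function.Exact (LinearMap.lsmul R N₂ x) q₂) :
    ExtConcentrated I' (a + 1) (b + 1) N₁' N₂' := by
  have hreg := h.isSMulRegular h₁ h₂
  obtain ⟨⟨e₁⟩, ⟨e₂⟩, h₀⟩ := h
  refine ⟨nonempty_extQuot_succ_equiv hI' hx (hreg _) e₁ q₁ hq₁ hxq₁,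
    nonempty_extQuot_succ_equiv hI' hx (hreg _) e₂ q₂ hq₂ hxq₂, fun n ha hb => ?_⟩
  cases n with
  | zero => exact subsingleton_extQuot_zero hI' hx (hreg 0)
  | succ n =>
    have := h₀ n (by lia) (by lia)
    exact subsingleton_extQuot_succ hI' hx (hreg _)

end ExtConcentrated

section MayerVietoris

variable {I J : Ideal R}

theorem smul_extQuot_eq_zero {x : R} (hx : x ∈ I) (n : ℕ) (y : ExtQuot I n) : x • y = 0 := by
  have h : x • 𝟙 (ModuleCat.of R (R ⧸ I)) = 0 := by
    ext1
    refine LinearMap.ext fun z => ?_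
    obtain ⟨f, rfl⟩ := Submodule.Quotient.mk_surjective _ z
    exact (Submodule.Quotient.mk_eq_zero I).2 (I.mul_mem_right f hx)
  have h' := LinearMap.congr_fun
    (extPrecomp_smul_id (ModuleCat.of R (R ⧸ I)) (ModuleCat.of R R) n x) y
  rw [h] at h'
  simpa [extPrecomp] using h'.symm

theorem nonempty_extQuot_inf_equiv_prod (I J : Ideal R) (n : ℕ)
    (h : extPrecomp (ModuleCat.of R R) n (mayerVietorisComplex I J).g = 0)
    [Subsingleton (ExtQuot (I ⊔ J) (n + 1))] :
    Nonempty (ExtQuot (I ⊓ J) n ≃ₗ[R] ExtQuot I n × ExtQuot J n) := by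
  have : Subsingleton (Ext (mayerVietorisComplex I J).X₃ (ModuleCat.of R R) (n + 1)) :=
    ‹Subsingleton (ExtQuot (I ⊔ J) (n + 1))›
  obtain ⟨e⟩ := nonempty_ext_equiv_of_extPrecomp_eq_zero (mayerVietorisComplex_shortExact I J)
    (ModuleCat.of R R) n h
  exact ⟨e ≪≫ₗ extProdEquiv _ _ _ n⟩

theorem nonempty_extQuot_inf_equiv_sup (I J : Ideal R) (n : ℕ)
    [Subsingleton (ExtQuot I n)] [Subsingleton (ExtQuot J n)]
    (h : extPrecomp (ModuleCat.of R R) (n + 1) (mayerVietorisComplex I J).g = 0) :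
    Nonempty (ExtQuot (I ⊓ J) n ≃ₗ[R] ExtQuot (I ⊔ J) (n + 1)) := by
  have : Subsingleton (Ext (mayerVietorisComplex I J).X₂ (ModuleCat.of R R) n) :=
    (extProdEquiv (R ⧸ I) (R ⧸ J) _ n).toEquiv.subsingleton
  exact nonempty_ext_equiv_ext_succ (mayerVietorisComplex_shortExact I J) (ModuleCat.of R R) n h

theorem extPrecomp_mayerVietorisComplex_eq_zero_of_sup (I J : Ideal R) (n : ℕ)
    [Subsingleton (ExtQuot (I ⊔ J) n)] :
    extPrecomp (ModuleCat.of R R) n (mayerVietorisComplex I J).g = 0 := by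
  have : Subsingleton (Ext (mayerVietorisComplex I J).X₃ (ModuleCat.of R R) n) :=
    ‹Subsingleton (ExtQuot (I ⊔ J) n)›
  exact LinearMap.ext fun y => by rw [Subsingleton.elim y 0, map_zero, map_zero]

/-- The restriction map vanishes as soon as an element of `I` is regular on its target. -/
theorem extPrecomp_mayerVietorisComplex_eq_zero_of_regular {x : R} (hx : x ∈ I) (n : ℕ)
    (hI : IsSMulRegular (ExtQuot I n) x) (hJ : IsSMulRegular (ExtQuot J n) x) :
    extPrecomp (ModuleCat.of R R) n (mayerVietorisComplex I J).g = 0 := by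
  refine LinearMap.ext fun y => ((LinearEquiv.isSMulRegular_congr
    (extProdEquiv (R ⧸ I) (R ⧸ J) (ModuleCat.of R R) n) x).2
    (isSMulRegular_prod hI hJ)) ?_
  have h : x • y = 0 := smul_extQuot_eq_zero (Ideal.mem_sup_left hx) n y
  exact ((map_smul _ x y).symm.trans ((congrArg _ h).trans (map_zero _))).trans
    (smul_zero x).symm

theorem isSMulRegular_of_subsingleton (M : Type*) [AddCommGroup M] [Module R M] [Subsingleton M]
    (x : R) : IsSMulRegular M x :=
  fun _ _ _ => Subsingleton.elim _ _

theorem extPrecomp_mayerVietorisComplex_eq_zero (I J : Ideal R) (n : ℕ)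
    [Subsingleton (ExtQuot I n)] [Subsingleton (ExtQuot J n)] :
    extPrecomp (ModuleCat.of R R) n (mayerVietorisComplex I J).g = 0 :=
  extPrecomp_mayerVietorisComplex_eq_zero_of_regular I.zero_mem n
    (isSMulRegular_of_subsingleton _ _) (isSMulRegular_of_subsingleton _ _)

theorem ExtConcentrated.inf {a c : ℕ} {N₁ N₂ N : Type*} [AddCommGroup N₁] [Module R N₁]
    [AddCommGroup N₂] [Module R N₂] [AddCommGroup N] [Module R N]
    (hI : ExtConcentrated I a a N₁ N₁) (hJ : ExtConcentrated J a a N₂ N₂)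
    (hIJ : ExtConcentrated (I ⊔ J) (c + 1) (c + 1) N N) (hac : a < c) :
    ExtConcentrated (I ⊓ J) a c (N₁ × N₂) N := by
  obtain ⟨⟨e₁⟩, -, h₁⟩ := hI
  obtain ⟨⟨e₂⟩, -, h₂⟩ := hJ
  obtain ⟨⟨e⟩, -, h⟩ := hIJ
  refine ⟨?_, ?_, fun n hna hnc => ?_⟩
  · have := h a (by lia) (by lia)
    have := h (a + 1) (by lia) (by lia)
    obtain ⟨e'⟩ := nonempty_extQuot_inf_equiv_prod I J a
      (extPrecomp_mayerVietorisComplex_eq_zero_of_sup I J a)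
    exact ⟨e' ≪≫ₗ e₁.prodCongr e₂⟩
  · have := h₁ c (by lia) (by lia)
    have := h₁ (c + 1) (by lia) (by lia)
    have := h₂ c (by lia) (by lia)
    have := h₂ (c + 1) (by lia) (by lia)
    obtain ⟨e'⟩ := nonempty_extQuot_inf_equiv_sup I J c
      (extPrecomp_mayerVietorisComplex_eq_zero I J (c + 1))
    exact ⟨e' ≪≫ₗ e⟩
  · have := h₁ n hna hna
    have := h₂ n hna hna
    have := h (n + 1) (by lia) (by lia)
    have : Subsingleton (Ext (mayerVietorisComplex I J).X₂ (ModuleCat.of R R) n) :=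
      (extProdEquiv (R ⧸ I) (R ⧸ J) _ n).toEquiv.subsingleton
    have : Subsingleton (Ext (mayerVietorisComplex I J).X₃ (ModuleCat.of R R) (n + 1)) := h (n + 1)
      (by lia) (by lia)
    exact subsingleton_ext_X₁ (mayerVietorisComplex_shortExact I J) (ModuleCat.of R R) n

theorem nonempty_extQuot_inf_equiv {N N₁ N₂ N₁' N₂' : Type*} [AddCommGroup N] [Module R N]
    [AddCommGroup N₁] [Module R N₁] [AddCommGroup N₂] [Module R N₂] [AddCommGroup N₁']
    [Module R N₁'] [AddCommGroup N₂'] [Module R N₂']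
    (hI : ExtConcentrated I 2 2 N N) (hJ : ExtConcentrated J 3 5 N₁ N₂)
    (hIJ : ExtConcentrated (I ⊔ J) 5 7 N₁' N₂') {x : R} (hx : x ∈ I) (hN₂ : IsSMulRegular N₂ x) :
    Nonempty (ExtQuot (I ⊓ J) 2 ≃ₗ[R] N) ∧ Nonempty (ExtQuot (I ⊓ J) 3 ≃ₗ[R] N₁) ∧
      Nonempty (ExtQuot (I ⊓ J) 4 ≃ₗ[R] N₁') ∧ Nonempty (ExtQuot (I ⊓ J) 5 ≃ₗ[R] N₂) ∧
      Nonempty (ExtQuot (I ⊓ J) 6 ≃ₗ[R] N₂') := by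
  obtain ⟨⟨e⟩, -, h⟩ := hI
  obtain ⟨⟨e₁⟩, ⟨e₂⟩, h₁⟩ := hJ
  obtain ⟨⟨e₁'⟩, ⟨e₂'⟩, h₁'⟩ := hIJ
  have := h 3 (by simp) (by simp)
  have := h 4 (by simp) (by simp)
  have := h 5 (by simp) (by simp)
  have := h 6 (by simp) (by simp)
  have := h 7 (by simp) (by simp)
  have := h₁ 2 (by simp) (by simp)
  have := h₁ 4 (by simp) (by simp)
  have := h₁ 6 (by simp) (by simp)
  have := h₁ 7 (by simp) (by simp)
  have := h₁' 2 (by simp) (by simp)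
  have := h₁' 3 (by simp) (by simp)
  have := h₁' 4 (by simp) (by simp)
  have := h₁' 6 (by simp) (by simp)
  have h₅ := extPrecomp_mayerVietorisComplex_eq_zero_of_regular (J := J) hx 5
    (isSMulRegular_of_subsingleton _ _) ((LinearEquiv.isSMulRegular_congr e₂ x).2 hN₂)
  obtain ⟨f₂⟩ := nonempty_extQuot_inf_equiv_prod I J 2
    (extPrecomp_mayerVietorisComplex_eq_zero_of_sup I J 2)
  obtain ⟨f₃⟩ := nonempty_extQuot_inf_equiv_prod I J 3
    (extPrecomp_mayerVietorisComplex_eq_zero_of_sup I J 3)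
  obtain ⟨f₄⟩ := nonempty_extQuot_inf_equiv_sup I J 4 h₅
  obtain ⟨f₅⟩ := nonempty_extQuot_inf_equiv_prod I J 5 h₅
  obtain ⟨f₆⟩ := nonempty_extQuot_inf_equiv_sup I J 6
    (extPrecomp_mayerVietorisComplex_eq_zero I J 7)
  have : Unique (ExtQuot J 2) := uniqueOfSubsingleton 0
  have : Unique (ExtQuot I 3) := uniqueOfSubsingleton 0
  have : Unique (ExtQuot I 5) := uniqueOfSubsingleton 0
  exact ⟨⟨f₂ ≪≫ₗ LinearEquiv.prodUnique ≪≫ₗ e⟩, ⟨f₃ ≪≫ₗ LinearEquiv.uniqueProd ≪≫ₗ e₁⟩,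
    ⟨f₄ ≪≫ₗ e₁'⟩, ⟨f₅ ≪≫ₗ LinearEquiv.uniqueProd ≪≫ₗ e₂⟩, ⟨f₆ ≪≫ₗ e₂'⟩⟩

end MayerVietoris

theorem extConcentrated_bot : ExtConcentrated (⊥ : Ideal R) 0 0 (R ⧸ (⊥ : Ideal R))
    (R ⧸ (⊥ : Ideal R)) := by
  let e : (R ⧸ (⊥ : Ideal R)) ≃ₗ[R] R := Submodule.quotEquivOfEqBot _ rfl
  have he : Nonempty (ExtQuot (⊥ : Ideal R) 0 ≃ₗ[R] (R ⧸ (⊥ : Ideal R))) :=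
    ⟨Ext.linearEquiv₀ ≪≫ₗ ModuleCat.homLinearEquiv (S := R) ≪≫ₗ
      e.congrLeft R R ≪≫ₗ LinearMap.ringLmapEquivSelf R R R ≪≫ₗ e.symm⟩
  refine ⟨he, he, fun n hn _ => ?_⟩
  have : Module.Projective R (R ⧸ (⊥ : Ideal R)) := Module.Projective.of_equiv e.symm
  obtain ⟨n, rfl⟩ := Nat.exists_eq_succ_of_ne_zero hn
  exact Ext.subsingleton_of_projective _ _ _

end CyclicModules

section MonomialIdeals

variable {σ k : Type*} [CommRing k]

variable (k) in
/-- The ideal generated by the `m`-th powers of the variables in `s`. -/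
def powIdeal (m : ℕ) (s : Finset σ) : Ideal (MvPolynomial σ k) :=
  Ideal.span ((fun i => X i ^ m) '' (s : Set σ))

theorem mem_powIdeal {m : ℕ} {s : Finset σ} {f : MvPolynomial σ k} :
    f ∈ powIdeal k m s ↔ ∀ d ∈ f.support, ∃ i ∈ s, m ≤ d i := by
  have h : (fun i => X i ^ m : σ → MvPolynomial σ k) =
      (fun d => monomial d (1 : k)) ∘ fun i => Finsupp.single i m := by
    ext1 i
    exact X_pow_eq_monomial
  rw [powIdeal, h, Set.image_comp, mem_ideal_span_monomial_image]
  simp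

theorem powIdeal_empty (m : ℕ) : powIdeal k m (∅ : Finset σ) = ⊥ := by
  simp [powIdeal]

theorem mem_powIdeal_of_X_pow_mul_mem {m : ℕ} {j : σ} {s : Finset σ} (hj : j ∉ s)
    {f : MvPolynomial σ k} (h : X j ^ m * f ∈ powIdeal k m s) : f ∈ powIdeal k m s := by
  rw [mem_powIdeal] at h ⊢
  intro d hd
  obtain ⟨i, hi, hid⟩ := h (Finsupp.single j m + d) (by
    rw [X_pow_eq_monomial, mem_support_iff, coeff_monomial_mul, one_mul]
    exact mem_support_iff.1 hd)
  have hij : j ≠ i := fun e => hj (e ▸ hi)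
  exact ⟨i, hi, by simpa [Finsupp.single_eq_of_ne' hij] using hid⟩

theorem isSMulRegular_powIdeal {m : ℕ} {j : σ} {s : Finset σ} (hj : j ∉ s) :
    IsSMulRegular (MvPolynomial σ k ⧸ powIdeal k m s) (X j ^ m : MvPolynomial σ k) :=
  isSMulRegular_quotient_of_mul_mem fun _ => mem_powIdeal_of_X_pow_mul_mem hj

theorem isSMulRegular_powIdeal_inf {m : ℕ} {j : σ} {s t : Finset σ} (hs : j ∉ s) (ht : j ∉ t) :
    IsSMulRegular (MvPolynomial σ k ⧸ powIdeal k m s ⊓ powIdeal k m t)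
      (X j ^ m : MvPolynomial σ k) :=
  isSMulRegular_quotient_of_mul_mem fun _ h =>
    ⟨mem_powIdeal_of_X_pow_mul_mem hs h.1, mem_powIdeal_of_X_pow_mul_mem ht h.2⟩

variable [DecidableEq σ]

theorem powIdeal_insert (m : ℕ) (j : σ) (s : Finset σ) :
    powIdeal k m (insert j s) = powIdeal k m s ⊔ Ideal.span {X j ^ m} := by
  rw [powIdeal, Finset.coe_insert, Set.image_insert_eq, Ideal.span_insert, sup_comm]
  rfl

theorem powIdeal_union (m : ℕ) (s t : Finset σ) :
    powIdeal k m (s ∪ t) = powIdeal k m s ⊔ powIdeal k m t := by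
  rw [powIdeal, Finset.coe_union, Set.image_union, Ideal.span_union]
  rfl

theorem powIdeal_insert_inf_insert (m : ℕ) (j : σ) (s t : Finset σ) :
    powIdeal k m (insert j s) ⊓ powIdeal k m (insert j t) =
      powIdeal k m s ⊓ powIdeal k m t ⊔ Ideal.span {X j ^ m} := by
  apply le_antisymm
  · rintro f ⟨hs, ht⟩
    rw [f.as_sum]
    refine Ideal.sum_mem _ fun d hd => ?_
    obtain ⟨i, hi, hid⟩ := mem_powIdeal.1 hs d hd
    obtain ⟨i', hi', hid'⟩ := mem_powIdeal.1 ht d hd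
    by_cases hj : m ≤ d j
    · refine Ideal.mem_sup_right (Ideal.mem_span_singleton.2 ?_)
      rw [X_pow_eq_monomial, monomial_dvd_monomial]
      exact ⟨Or.inr (by simpa using hj), one_dvd _⟩
    · refine Ideal.mem_sup_left ⟨mem_powIdeal.2 fun d' hd' => ?_, mem_powIdeal.2 fun d' hd' => ?_⟩
      all_goals obtain rfl := Finset.mem_singleton.1 (support_monomial_subset hd')
      · exact ⟨i, (Finset.mem_insert.1 hi).resolve_left (by rintro rfl; exact hj hid), hid⟩
      · exact ⟨i', (Finset.mem_insert.1 hi').resolve_left (by rintro rfl; exact hj hid'), hid'⟩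
  · rw [powIdeal_insert, powIdeal_insert]
    exact sup_le (inf_le_inf le_sup_left le_sup_left) (le_inf le_sup_right le_sup_right)

end MonomialIdeals

section ExtMonomialIdeals

variable {σ k : Type u} [DecidableEq σ] [CommRing k] (m : ℕ)

theorem extConcentrated_powIdeal (s : Finset σ) {n : ℕ} (hn : s.card = n) :
    ExtConcentrated (powIdeal k m s) n n (MvPolynomial σ k ⧸ powIdeal k m s)
      (MvPolynomial σ k ⧸ powIdeal k m s) := by
  subst hn
  induction s using Finset.induction_on with
  | empty =>
    rw [powIdeal_empty]
    exact extConcentrated_bot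
  | insert j s hj ih =>
    have hI := powIdeal_insert (k := k) m j s
    have hx := isSMulRegular_powIdeal (k := k) (m := m) hj
    rw [Finset.card_insert_of_notMem hj]
    have hq := Submodule.factor_surjective (le_sup_left.trans hI.ge)
    exact ih.quotient hI hx hx hx _ hq (exact_lsmul_factor hI) _ hq (exact_lsmul_factor hI)

/-- Adjoining the `m`-th power of a further variable shifts the degrees by one. -/
theorem ExtConcentrated.insert {m : ℕ} {j : σ} {s t w : Finset σ} {a b : ℕ} (hs : j ∉ s)
    (ht : j ∉ t) (hw : j ∉ w)
    (h : ExtConcentrated (powIdeal k m s ⊓ powIdeal k m t) a b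
      ((MvPolynomial σ k ⧸ powIdeal k m s) × (MvPolynomial σ k ⧸ powIdeal k m t))
      (MvPolynomial σ k ⧸ powIdeal k m w)) :
    ExtConcentrated (powIdeal k m (insert j s) ⊓ powIdeal k m (insert j t)) (a + 1) (b + 1)
      ((MvPolynomial σ k ⧸ powIdeal k m (insert j s)) ×
        (MvPolynomial σ k ⧸ powIdeal k m (insert j t)))
      (MvPolynomial σ k ⧸ powIdeal k m (insert j w)) :=
  h.quotient (powIdeal_insert_inf_insert m j s t) (isSMulRegular_powIdeal_inf hs ht)
    (isSMulRegular_prod (isSMulRegular_powIdeal hs) (isSMulRegular_powIdeal ht))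
    (isSMulRegular_powIdeal hw)
    ((Submodule.factor (le_sup_left.trans (powIdeal_insert m j s).ge)).prodMap
      (Submodule.factor (le_sup_left.trans (powIdeal_insert m j t).ge)))
    ((Submodule.factor_surjective (le_sup_left.trans (powIdeal_insert m j s).ge)).prodMap
      (Submodule.factor_surjective (le_sup_left.trans (powIdeal_insert m j t).ge)))
    (exact_lsmul_prodMap (exact_lsmul_factor (powIdeal_insert m j s))
      (exact_lsmul_factor (powIdeal_insert m j t)))
    _ (Submodule.factor_surjective (le_sup_left.trans (powIdeal_insert m j w).ge))
    (exact_lsmul_factor (powIdeal_insert m j w))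

end ExtMonomialIdeals

end ExtComputation

theorem single_add_single_add_single_le {σ : Type*} {a b c : σ} (hab : a ≠ b) (hac : a ≠ c)
    (hbc : b ≠ c) (m : ℕ) (d : σ →₀ ℕ) :
    Finsupp.single a m + Finsupp.single b m + Finsupp.single c m ≤ d ↔
      m ≤ d a ∧ m ≤ d b ∧ m ≤ d c := by
  classical
  refine ⟨fun h => ⟨?_, ?_, ?_⟩, fun ⟨ha, hb, hc⟩ i => ?_⟩
  · simpa [hab, hac] using h a
  · simpa [hab.symm, hbc] using h b
  · simpa [hac.symm, hbc.symm] using h c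
  · by_cases h₁ : a = i
    · subst h₁
      simpa [hab, hac] using ha
    by_cases h₂ : b = i
    · subst h₂
      simpa [hab.symm, hbc] using hb
    by_cases h₃ : c = i
    · subst h₃
      simpa [hac.symm, hbc.symm] using hc
    simp [Ne.symm h₁, Ne.symm h₂, Ne.symm h₃]

theorem X_mul_X_mul_X_pow {σ k : Type*} [CommSemiring k] (a b c : σ) (m : ℕ) :
    (X a * X b * X c : MvPolynomial σ k) ^ m =
      monomial (Finsupp.single a m + Finsupp.single b m + Finsupp.single c m) 1 := by
  simp only [mul_pow, X_pow_eq_monomial, monomial_mul, one_mul]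

theorem J8_eq (m : ℕ) : J8 m = powIdeal ℂ m {4, 5} ⊓
    (powIdeal ℂ m {1, 2, 6} ⊓ powIdeal ℂ m {0, 3, 7}) := by
  ext f
  rw [J8]
  simp only [X_mul_X_mul_X_pow, ← Set.image_insert_eq (f := fun d => monomial d (1 : ℂ)),
    ← Set.image_singleton (f := fun d => monomial d (1 : ℂ))]
  rw [mem_ideal_span_monomial_image, Ideal.mem_inf, Ideal.mem_inf, mem_powIdeal, mem_powIdeal,
    mem_powIdeal, ← forall₂_and, ← forall₂_and]
  refine forall₂_congr fun d _ => ?_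
  simp only [Set.exists_mem_insert, Set.mem_singleton_iff, exists_eq_left, Finset.mem_insert,
    Finset.mem_singleton, or_and_right, exists_or]
  simp +decide only [single_add_single_add_single_le, ne_eq]
  generalize (m ≤ d 0) = p₀, (m ≤ d 1) = p₁, (m ≤ d 2) = p₂, (m ≤ d 3) = p₃, (m ≤ d 4) = p₄,
    (m ≤ d 5) = p₅, (m ≤ d 6) = p₆, (m ≤ d 7) = p₇
  grind

theorem extConcentrated_powIdeal_inf (m : ℕ) :
    ExtConcentrated (powIdeal ℂ m {1, 2, 6} ⊓ powIdeal ℂ m {0, 3, 7} : Ideal S8) 3 5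
      ((S8 ⧸ powIdeal ℂ m {1, 2, 6}) × (S8 ⧸ powIdeal ℂ m {0, 3, 7}))
      (S8 ⧸ powIdeal ℂ m {0, 1, 2, 3, 6, 7}) := by
  refine (extConcentrated_powIdeal m _ (by simp)).inf (extConcentrated_powIdeal m _ (by simp)) ?_
    (by simp)
  rw [← powIdeal_union, show ({1, 2, 6} ∪ {0, 3, 7} : Finset (Fin 8)) = {0, 1, 2, 3, 6, 7} by
    decide]
  exact extConcentrated_powIdeal m _ (by simp)

theorem extConcentrated_powIdeal_sup_inf (m : ℕ) :
    ExtConcentrated (powIdeal ℂ m {4, 5} ⊔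
        powIdeal ℂ m {1, 2, 6} ⊓ powIdeal ℂ m {0, 3, 7} : Ideal S8) 5 7
      ((S8 ⧸ powIdeal ℂ m {1, 2, 4, 5, 6}) × (S8 ⧸ powIdeal ℂ m {0, 3, 4, 5, 7}))
      (S8 ⧸ powIdeal ℂ m {0, 1, 2, 3, 4, 5, 6, 7}) := by
  have h := ((extConcentrated_powIdeal_inf m).insert (j := 5) (by decide) (by decide)
    (by decide)).insert (j := 4) (by decide) (by decide) (by decide)
  have h₄₅ : powIdeal ℂ m ({4, 5} : Finset (Fin 8)) =
      Ideal.span {X 5 ^ m} ⊔ Ideal.span {X 4 ^ m} := by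
    rw [powIdeal_insert, powIdeal, Finset.coe_singleton, Set.image_singleton]
  rw [h₄₅, sup_comm, ← sup_assoc, ← powIdeal_insert_inf_insert, ← powIdeal_insert_inf_insert]
  rw [show ({1, 2, 4, 5, 6} : Finset (Fin 8)) = insert 4 (insert 5 {1, 2, 6}) by decide,
    show ({0, 3, 4, 5, 7} : Finset (Fin 8)) = insert 4 (insert 5 {0, 3, 7}) by decide,
    show ({0, 1, 2, 3, 4, 5, 6, 7} : Finset (Fin 8)) =
      insert 4 (insert 5 {0, 1, 2, 3, 6, 7}) by decide]
  exact h

/-- Computation of the modules `Ext^i_S(S/J_m, S)` for the example of the blowup of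
`ℙ(1,1,2,2,3,6)` (Example 3; `x_i` is `X (i-1)`). -/
theorem ext_computation_example_three (m : ℕ) (hm : 1 ≤ m) :
    Nonempty (ExtJ8 2 m ≃ₗ[S8] (S8 ⧸ Ideal.span {(X 4 : S8) ^ m, (X 5 : S8) ^ m})) ∧
    Nonempty (ExtJ8 3 m ≃ₗ[S8]
      ((S8 ⧸ Ideal.span {(X 1 : S8) ^ m, (X 2 : S8) ^ m, (X 6 : S8) ^ m}) ×
       (S8 ⧸ Ideal.span {(X 0 : S8) ^ m, (X 3 : S8) ^ m, (X 7 : S8) ^ m}))) ∧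
    Nonempty (ExtJ8 4 m ≃ₗ[S8]
      ((S8 ⧸ Ideal.span {(X 1 : S8) ^ m, (X 2 : S8) ^ m, (X 4 : S8) ^ m, (X 5 : S8) ^ m,
          (X 6 : S8) ^ m}) ×
       (S8 ⧸ Ideal.span {(X 0 : S8) ^ m, (X 3 : S8) ^ m, (X 4 : S8) ^ m, (X 5 : S8) ^ m,
          (X 7 : S8) ^ m}))) ∧
    Nonempty (ExtJ8 5 m ≃ₗ[S8] (S8 ⧸ Ideal.span {(X 0 : S8) ^ m, (X 1 : S8) ^ m,
      (X 2 : S8) ^ m, (X 3 : S8) ^ m, (X 6 : S8) ^ m, (X 7 : S8) ^ m})) ∧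
    Nonempty (ExtJ8 6 m ≃ₗ[S8] (S8 ⧸ Ideal.span {(X 0 : S8) ^ m, (X 1 : S8) ^ m,
      (X 2 : S8) ^ m, (X 3 : S8) ^ m, (X 4 : S8) ^ m, (X 5 : S8) ^ m, (X 6 : S8) ^ m,
      (X 7 : S8) ^ m})) := by
  obtain ⟨⟨e₂⟩, ⟨e₃⟩, ⟨e₄⟩, ⟨e₅⟩, ⟨e₆⟩⟩ := nonempty_extQuot_inf_equiv (x := X 4 ^ m)
    (extConcentrated_powIdeal m {4, 5} (by simp)) (extConcentrated_powIdeal_inf m)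
    (extConcentrated_powIdeal_sup_inf m) (Ideal.subset_span ⟨4, by simp, rfl⟩)
    (isSMulRegular_powIdeal (by decide))
  rw [← J8_eq] at e₂ e₃ e₄ e₅ e₆
  have hExt (n : ℕ) := nonempty_ext_equiv (ModuleCat.of S8 (S8 ⧸ J8 m)) (ModuleCat.of S8 S8) n
  obtain ⟨f₂⟩ := hExt 1
  obtain ⟨f₃⟩ := hExt 2
  obtain ⟨f₄⟩ := hExt 3
  obtain ⟨f₅⟩ := hExt 4
  obtain ⟨f₆⟩ := hExt 5
  rw [
    show Ideal.span {(X 4 : S8) ^ m, (X 5 : S8) ^ m} =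
      powIdeal ℂ m {4, 5} by simp [powIdeal, Set.image_insert_eq],
    show Ideal.span {(X 1 : S8) ^ m, (X 2 : S8) ^ m, (X 6 : S8) ^ m} =
      powIdeal ℂ m {1, 2, 6} by simp [powIdeal, Set.image_insert_eq],
    show Ideal.span {(X 0 : S8) ^ m, (X 3 : S8) ^ m, (X 7 : S8) ^ m} =
      powIdeal ℂ m {0, 3, 7} by simp [powIdeal, Set.image_insert_eq],
    show Ideal.span {(X 1 : S8) ^ m, (X 2 : S8) ^ m, (X 4 : S8) ^ m, (X 5 : S8) ^ m,
        (X 6 : S8) ^ m} =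
      powIdeal ℂ m {1, 2, 4, 5, 6} by simp [powIdeal, Set.image_insert_eq],
    show Ideal.span {(X 0 : S8) ^ m, (X 3 : S8) ^ m, (X 4 : S8) ^ m, (X 5 : S8) ^ m,
        (X 7 : S8) ^ m} =
      powIdeal ℂ m {0, 3, 4, 5, 7} by simp [powIdeal, Set.image_insert_eq],
    show Ideal.span {(X 0 : S8) ^ m, (X 1 : S8) ^ m, (X 2 : S8) ^ m, (X 3 : S8) ^ m,
        (X 6 : S8) ^ m, (X 7 : S8) ^ m} =
      powIdeal ℂ m {0, 1, 2, 3, 6, 7} by simp [powIdeal, Set.image_insert_eq],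
    show Ideal.span {(X 0 : S8) ^ m, (X 1 : S8) ^ m, (X 2 : S8) ^ m, (X 3 : S8) ^ m,
        (X 4 : S8) ^ m, (X 5 : S8) ^ m, (X 6 : S8) ^ m, (X 7 : S8) ^ m} =
      powIdeal ℂ m {0, 1, 2, 3, 4, 5, 6, 7} by simp [powIdeal, Set.image_insert_eq]]
  exact ⟨⟨f₂ ≪≫ₗ e₂⟩, ⟨f₃ ≪≫ₗ e₃⟩, ⟨f₄ ≪≫ₗ e₄⟩, ⟨f₅ ≪≫ₗ e₅⟩, ⟨f₆ ≪≫ₗ e₆⟩⟩
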